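/- arXiv:1509.04346 — 2 statements merged into one kernel-verified Lean document; each statement's English description precedes it below -/
import Mathlib

section
/- Every ultrametric space M is isometrically embeddable into M_s(Well(V)), where V := Spec(M) and s is the degree sequence of M, i.e., s(r) := s_M(r) for each r ∈ V*. -/
universe u

open Cardinal

/-- A point of the space `M_s(J)`: a function `f` defined on `V* = V \ {0}` such that
`f r` is an element of the cardinal `s r` (viewed as an initial ordinal), whose support
`{r ∈ V* | f r ≠ 0}` belongs to the collection `J`.  (The function is extended by `0`
outside `V*`.) -/
structure MsPoint (V : Set ℝ) (s : ℝ → Cardinal.{u}) (J : Set (Set ℝ)) :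
    Type (u + 1) where
  toFun : ℝ → Ordinal.{u}
  lt_ord : ∀ r ∈ V \ {0}, toFun r < (s r).ord
  eq_zero : ∀ r ∉ V \ {0}, toFun r = 0
  supp_mem : {r | r ∈ V \ {0} ∧ toFun r ≠ 0} ∈ J

/-- The ultrametric distance on `M_s(J)`:
`d(f, g) = sup {r ∈ V* | f r ≠ g r}` (with `sup ∅ = 0`). -/
noncomputable def msDist {V : Set ℝ} {s : ℝ → Cardinal.{u}} {J : Set (Set ℝ)}
    (f g : MsPoint V s J) : ℝ :=
  sSup {r | r ∈ V \ {0} ∧ f.toFun r ≠ g.toFun r}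

/-- `Bound(V)`: the subsets of `V* = V \ {0}` which are bounded above in `ℝ`. -/
def BoundSets (V : Set ℝ) : Set (Set ℝ) := {A | A ⊆ V \ {0} ∧ BddAbove A}

/-- `Fin(V)`: the finite subsets of `V* = V \ {0}`. -/
def FinSets (V : Set ℝ) : Set (Set ℝ) := {A | A ⊆ V \ {0} ∧ A.Finite}

/-- `Well(V)`: the subsets of `V* = V \ {0}` which are well-ordered under `≥`
(equivalently, on which `>` is well-founded). -/
def WellSets (V : Set ℝ) : Set (Set ℝ) :=
  {A | A ⊆ V \ {0} ∧ A.WellFoundedOn (· > · : ℝ → ℝ → Prop)}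

section Defs

open Metric

variable (M : Type u) [MetricSpace M]

/-- The spectrum of a point `a`: the set of distances from `a` to points of the space. -/
def specAt (a : M) : Set ℝ := Set.range (dist a)

/-- The spectrum of the whole space. -/
def specSet : Set ℝ := {r | ∃ x y : M, dist x y = r}

/-- The nerve of `M`: closed balls `B̂(a, r)` with `a ∈ M` and `r ∈ Spec(M, a)`. -/
def nerv : Set (Set M) := {B | ∃ (a : M) (r : ℝ), r ∈ specAt M a ∧ B = closedBall a r}

/-- The sons of a set `B`: the open balls of radius `δ(B)` contained in `B`. -/
def sons (B : Set M) : Set (Set M) :=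
  {S | (∃ a : M, S = ball a (Metric.diam B)) ∧ S ⊆ B}

/-- The degree sequence of `M`: `s_M(r)` is the supremum of the number of sons of the
members of the nerve of diameter `r`. -/
noncomputable def degSeq (r : ℝ) : Cardinal.{u} :=
  sSup {c | ∃ B ∈ nerv M, Metric.diam B = r ∧ c = Cardinal.mk (sons M B)}

end Defs

open Metric

/-- The elements of a set can be labelled injectively by the ordinals below its cardinality, with
a prescribed element labelled `0`. -/
theorem exists_ordinal_labelling {α : Type u} (T : Set α) {t₀ : α} (h₀ : t₀ ∈ T) :
    ∃ g : α → Ordinal.{u}, Set.InjOn g T ∧ (∀ t ∈ T, g t < (Cardinal.mk T).ord) ∧ g t₀ = 0 := by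
  classical
  have hmk : Cardinal.mk (Set.Iio (Cardinal.mk T).ord) = Cardinal.lift.{u + 1} (Cardinal.mk T) := by
    rw [Cardinal.mk_Iio_ordinal, Cardinal.card_ord]
  obtain ⟨e⟩ : Nonempty (T ≃ Set.Iio (Cardinal.mk T).ord) := by
    refine Cardinal.lift_mk_eq'.1 ?_
    simp [hmk]
  have hpos : (0 : Ordinal) < (Cardinal.mk T).ord :=
    lt_of_le_of_lt (zero_le (a := (e ⟨t₀, h₀⟩ : Ordinal))) (e ⟨t₀, h₀⟩).2
  let e' := e.trans (Equiv.swap (e ⟨t₀, h₀⟩) ⟨0, hpos⟩)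
  refine ⟨fun t => if h : t ∈ T then e' ⟨t, h⟩ else 0, ?_, ?_, ?_⟩
  · intro a ha b hb hab
    simp only [dif_pos ha, dif_pos hb] at hab
    simpa using e'.injective (Subtype.ext hab)
  · intro t ht
    simp only [dif_pos ht]
    exact (e' ⟨t, ht⟩).2
  · simp [h₀, e']

section Ultrametric

variable {M : Type u} [MetricSpace M]

/-- The open balls of radius `r` centred at points of the closed ball `B`. -/
def openBallsIn (B : Set M) (r : ℝ) : Set (Set M) := (fun y => ball y r) '' B

theorem mk_sons_le_degSeq {B : Set M} (hB : B ∈ nerv M) :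
    Cardinal.mk (sons M B) ≤ degSeq M (diam B) := by
  refine le_csSup ⟨Cardinal.mk (Set M), ?_⟩ ⟨B, hB, rfl, rfl⟩
  rintro c ⟨C, -, -, rfl⟩
  exact Cardinal.mk_set_le _

/-- If `p` picks from each nonempty set a minimal element for the well-order of `M`, then the radii
`r` for which `p` picks a point of `closedBall x r` at distance exactly `r` from `x` form a set
well-ordered under `≥`. -/
theorem wellFoundedOn_dist_minimal {p : Set M → M}
    (hmin : ∀ B : Set M, ∀ y ∈ B, ¬ WellOrderingRel y (p B)) (x : M) {A : Set ℝ}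
    (hA : ∀ r ∈ A, dist (p (closedBall x r)) x = r) :
    A.WellFoundedOn (· > · : ℝ → ℝ → Prop) := by
  refine Subrelation.wf (r := InvImage WellOrderingRel fun r : A => p (closedBall x r)) ?_
    (InvImage.wf _ IsWellFounded.wf)
  rintro ⟨r, hr⟩ ⟨t, ht⟩ (hlt : r > t)
  have hmem : p (closedBall x t) ∈ closedBall x r := by
    rw [mem_closedBall, hA t ht]
    exact hlt.le
  rcases trichotomous_of WellOrderingRel (p (closedBall x r)) (p (closedBall x t)) with h | h | h
  · exact h
  · have := hA r hr
    rw [h, hA t ht] at this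
    exact absurd this hlt.ne
  · exact absurd h (hmin _ _ hmem)

variable [IsUltrametricDist M]

theorem diam_closedBall_of_mem_specAt {x : M} {r : ℝ} (hr : r ∈ specAt M x) :
    diam (closedBall x r) = r := by
  obtain ⟨y, rfl⟩ := hr
  refine le_antisymm (diam_le_of_forall_dist_le dist_nonneg fun a ha b hb => ?_) ?_
  · refine (dist_triangle_max a x b).trans (max_le ha ?_)
    rw [dist_comm]
    exact hb
  · exact dist_le_diam_of_mem isBounded_closedBall (mem_closedBall_self dist_nonneg)
      (by rw [mem_closedBall, dist_comm])

theorem openBallsIn_subset_sons {x : M} {r : ℝ} (hr : r ∈ specAt M x) :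
    openBallsIn (closedBall x r) r ⊆ sons M (closedBall x r) := by
  rintro _ ⟨y, hy, rfl⟩
  refine ⟨⟨y, by rw [diam_closedBall_of_mem_specAt hr]⟩, ?_⟩
  rw [IsUltrametricDist.closedBall_eq_of_mem hy]
  exact ball_subset_closedBall

theorem mk_openBallsIn_le_degSeq_of_mem_specAt {x : M} {r : ℝ} (hr : r ∈ specAt M x) :
    Cardinal.mk (openBallsIn (closedBall x r) r) ≤ degSeq M r := by
  have h := mk_sons_le_degSeq (M := M) ⟨x, r, hr, rfl⟩
  rw [diam_closedBall_of_mem_specAt hr] at h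
  exact (Cardinal.mk_le_mk_of_subset (openBallsIn_subset_sons hr)).trans h

theorem mk_openBallsIn_le_degSeq (x : M) {r : ℝ} (hr : r ∈ specSet M) :
    Cardinal.mk (openBallsIn (closedBall x r) r) ≤ degSeq M r := by
  by_cases hx : r ∈ specAt M x
  · exact mk_openBallsIn_le_degSeq_of_mem_specAt hx
  obtain ⟨a, b, rfl⟩ := hr
  have hsub : (openBallsIn (closedBall x (dist a b)) (dist a b)).Subsingleton := by
    have key : ∀ y ∈ closedBall x (dist a b), ball y (dist a b) = ball x (dist a b) := by
      intro y hy
      refine (IsUltrametricDist.ball_eq_of_mem (mem_ball.2 (lt_of_le_of_ne hy fun h => ?_))).symm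
      exact hx ⟨y, by rw [dist_comm, h]⟩
    rintro _ ⟨y, hy, rfl⟩ _ ⟨z, hz, rfl⟩
    exact (key y hy).trans (key z hz).symm
  refine (Cardinal.mk_le_one_iff_set_subsingleton.2 hsub).trans
    (le_trans ?_ (mk_openBallsIn_le_degSeq_of_mem_specAt (x := a) ⟨b, rfl⟩))
  rw [Cardinal.one_le_iff_ne_zero, Cardinal.mk_ne_zero_iff]
  exact ⟨⟨_, a, mem_closedBall_self dist_nonneg, rfl⟩⟩

end Ultrametric

/-- Every ultrametric space `M` is isometrically embeddable into
`M_s(Well(V))`, where `V = Spec(M)` and `s` is the degree sequence of `M`. -/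
theorem stmt10 (M : Type u) [MetricSpace M]
    (ultra : ∀ x y z : M, dist x z ≤ max (dist x y) (dist y z)) :
    ∃ f : M → MsPoint (specSet M) (degSeq M) (WellSets (specSet M)),
      ∀ x y : M, msDist (f x) (f y) = dist x y := by
  classical
  have : IsUltrametricDist M := ⟨ultra⟩
  rcases isEmpty_or_nonempty M with hM | hM
  · exact ⟨fun x => isEmptyElim x, fun x => isEmptyElim x⟩
  have hwf : WellFounded (WellOrderingRel : M → M → Prop) := IsWellFounded.wf
  have hp : ∀ B : Set M, ∃ p : M, (B.Nonempty → p ∈ B) ∧ ∀ y ∈ B, ¬ WellOrderingRel y p := by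
    intro B
    by_cases hB : B.Nonempty
    · exact ⟨hwf.min B hB, fun _ => hwf.min_mem B hB, fun y hy => hwf.not_lt_min B hy⟩
    · exact ⟨Classical.arbitrary M, fun h => absurd h hB, fun y hy => absurd ⟨y, hy⟩ hB⟩
  choose p hpmem hpmin using hp
  have hg : ∀ (B : Set M) (r : ℝ), ∃ g : Set M → Ordinal.{u}, B.Nonempty →
      Set.InjOn g (openBallsIn B r) ∧
      (∀ t ∈ openBallsIn B r, g t < (Cardinal.mk (openBallsIn B r)).ord) ∧
      g (ball (p B) r) = 0 := by
    intro B r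
    by_cases hB : B.Nonempty
    · obtain ⟨g, hg⟩ := exists_ordinal_labelling (openBallsIn B r) ⟨p B, hpmem B hB, rfl⟩
      exact ⟨g, fun _ => hg⟩
    · exact ⟨fun _ => 0, fun h => absurd h hB⟩
  choose g hg using hg
  have hpos : ∀ {r}, r ∈ specSet M \ {0} → 0 < r := by
    rintro _ ⟨⟨a, b, rfl⟩, h⟩
    exact lt_of_le_of_ne dist_nonneg (Ne.symm h)
  have hself : ∀ (x : M) {r}, 0 < r → x ∈ closedBall x r := fun x r h =>
    mem_closedBall_self h.le
  let F : M → MsPoint (specSet M) (degSeq M) (WellSets (specSet M)) := fun x =>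
    { toFun := fun r => if r ∈ specSet M \ {0} then g (closedBall x r) r (ball x r) else 0
      lt_ord := fun r hr => by
        have hx := hself x (hpos hr)
        rw [if_pos hr]
        exact ((hg _ r ⟨x, hx⟩).2.1 _ ⟨x, hx, rfl⟩).trans_le
          (Cardinal.ord_le_ord.2 (mk_openBallsIn_le_degSeq x hr.1))
      eq_zero := fun r hr => if_neg hr
      supp_mem := by
        refine ⟨fun r hr => hr.1, wellFoundedOn_dist_minimal hpmin x ?_⟩
        rintro r ⟨hr, hne⟩
        have hx : (closedBall x r).Nonempty := ⟨x, hself x (hpos hr)⟩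
        by_contra hdist
        refine hne ?_
        rw [if_pos hr, IsUltrametricDist.ball_eq_of_mem
          (mem_ball.2 (lt_of_le_of_ne (mem_closedBall.1 (hpmem _ hx)) hdist))]
        exact (hg _ r hx).2.2 }
  refine ⟨F, fun x y => ?_⟩
  rcases eq_or_ne x y with rfl | hxy
  · simp [msDist]
  have hd : dist x y ∈ specSet M \ {0} := ⟨⟨x, y, rfl⟩, dist_ne_zero.2 hxy⟩
  refine IsGreatest.csSup_eq ⟨⟨hd, fun h => ?_⟩, ?_⟩
  · have hy : y ∈ closedBall x (dist x y) := by rw [mem_closedBall, dist_comm]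
    have hx := hself x (hpos hd)
    simp only [F, if_pos hd, ← IsUltrametricDist.closedBall_eq_of_mem hy] at h
    have hball : ball x (dist x y) = ball y (dist x y) :=
      (hg _ _ ⟨x, hx⟩).1 ⟨x, hx, rfl⟩ ⟨y, hy, rfl⟩ h
    have hmem : x ∈ ball y (dist x y) := hball ▸ mem_ball_self (hpos hd)
    exact lt_irrefl _ (mem_ball.1 hmem)
  · rintro r ⟨hr, hne⟩
    by_contra! hlt
    have hy : y ∈ ball x r := by rwa [mem_ball, dist_comm]
    refine hne ?_
    simp only [F, if_pos hr, IsUltrametricDist.ball_eq_of_mem hy,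
      IsUltrametricDist.closedBall_eq_of_mem (ball_subset_closedBall hy)]
end

section
/- Let V ⊆ ℝ⁺ with 0 ∈ V and let s assign to each r ∈ V* a cardinal s(r) ≥ 2. Then the ultrametric space M_s(Fin(V)) is isometrically embeddable into every ultrametric space M satisfying property h with Spec(M) ⊇ V and s_M(r) ≥ s(r) for every r ∈ V*. -/
universe u

open Cardinal

section Defs

open Metric

variable (M : Type u) [MetricSpace M]

/-- Property `h`: all points of `M` have the same spectrum, and any two members of the
nerve of the same diameter have the same number of sons. -/
def PropH : Prop :=
  (∀ x x' : M, specAt M x = specAt M x') ∧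
    ∀ B ∈ nerv M, ∀ B' ∈ nerv M, Metric.diam B = Metric.diam B' →
      Cardinal.mk (sons M B) = Cardinal.mk (sons M B')

end Defs

open Metric in
lemma diam_closedBall_eq_of_dist_eq {M : Type*} [MetricSpace M] [IsUltrametricDist M]
    {a b : M} {r : ℝ} (hab : dist a b = r) : diam (closedBall a r) = r := by
  have hr : 0 ≤ r := hab ▸ dist_nonneg
  refine le_antisymm (diam_le_of_forall_dist_le hr fun x hx y hy => ?_) ?_
  · exact (dist_triangle_max x a y).trans (max_le hx (by rw [dist_comm]; exact hy))
  · calc r = dist a b := hab.symm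
      _ ≤ _ := dist_le_diam_of_mem isBounded_closedBall (mem_closedBall_self hr)
          (by rw [mem_closedBall, dist_comm, hab])

open Metric in
/-- Around every point `a` of a space with property `h`, one can choose `s_M(r)` many points,
with `a` among them, at mutual distance `r`. -/
lemma PropH.exists_equidistant {M : Type u} [MetricSpace M] [IsUltrametricDist M]
    (hh : PropH M) {r : ℝ} (hr : 0 < r) (hspec : r ∈ specSet M) {c : Cardinal.{u}}
    (hc : c ≠ 0) (hdeg : c ≤ degSeq M r) (a : M) :
    ∃ φ : Ordinal.{u} → M, φ 0 = a ∧
      ∀ α < c.ord, ∀ β < c.ord, α ≠ β → dist (φ α) (φ β) = r := by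
  classical
  obtain ⟨x, y, hxy⟩ := hspec
  have hra : r ∈ specAt M a := hh.1 x a ▸ ⟨y, hxy⟩
  obtain ⟨b, hb⟩ := id hra
  have hdiam : diam (closedBall a r) = r := diam_closedBall_eq_of_dist_eq hb
  have hnerv : closedBall a r ∈ nerv M := ⟨a, r, hra, rfl⟩
  have hle : c ≤ #(sons M (closedBall a r)) := by
    refine hdeg.trans (csSup_le' ?_)
    rintro _ ⟨B, hB, hBr, rfl⟩
    exact (hh.2 B hB _ hnerv (hBr.trans hdiam.symm)).le
  have hemb : Nonempty (Set.Iio c.ord ↪ sons M (closedBall a r)) := by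
    rw [← Cardinal.lift_mk_le', Cardinal.mk_Iio_ordinal, Cardinal.card_ord]
    simpa using hle
  obtain ⟨ψ⟩ := hemb
  have h0 : (0 : Ordinal.{u}) < c.ord := by
    rw [Cardinal.lt_ord, Ordinal.card_zero]
    exact pos_iff_ne_zero.2 hc
  let S₀ : sons M (closedBall a r) :=
    ⟨ball a r, ⟨a, by rw [hdiam]⟩, ball_subset_closedBall⟩
  let χ := ψ.trans (Equiv.swap (ψ ⟨0, h0⟩) S₀).toEmbedding
  have hχ : χ ⟨0, h0⟩ = S₀ := by simp [χ]
  have hcenter : ∀ S : sons M (closedBall a r), ∃ p : M, ball p r = S ∧ (S = S₀ → p = a) := by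
    intro S
    by_cases hS : S = S₀
    · exact ⟨a, by rw [hS], fun _ => rfl⟩
    · obtain ⟨p, hp⟩ := S.2.1
      exact ⟨p, by rw [hp, hdiam], fun h => absurd h hS⟩
  choose p hp hp₀ using hcenter
  have hmem : ∀ S, dist (p S) a ≤ r := fun S => S.2.2 (hp S ▸ mem_ball_self hr)
  refine ⟨fun α => if h : α < c.ord then p (χ ⟨α, h⟩) else a, ?_, ?_⟩
  · simp only [h0, dite_true]
    exact hp₀ _ hχ
  · intro α hα β hβ hne
    simp only [hα, hβ, dite_true]
    refine le_antisymm ((dist_triangle_max _ a _).trans (max_le (hmem _) ?_)) ?_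
    · rw [dist_comm]
      exact hmem _
    · by_contra! hlt
      refine hne (congrArg Subtype.val (χ.injective (Subtype.ext ?_) :
        (⟨α, hα⟩ : Set.Iio c.ord) = ⟨β, hβ⟩))
      rw [← hp (χ ⟨α, hα⟩), ← hp (χ ⟨β, hβ⟩)]
      exact IsUltrametricDist.ball_eq_of_mem (mem_ball'.2 hlt)

/-- Starting from a point `a`, move successively along the list `L`: at step `r`, the current
point `b` is replaced by `φ r b (f r)`. -/
def walkAlong {M : Type*} (φ : ℝ → M → Ordinal.{u} → M) (f : ℝ → Ordinal.{u}) : List ℝ → M → M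
  | [], a => a
  | r :: L, a => walkAlong φ f L (φ r a (f r))

section walkAlong

variable {M : Type*} {φ : ℝ → M → Ordinal.{u} → M} {f g : ℝ → Ordinal.{u}}

lemma walkAlong_filter (hφ : ∀ r a, φ r a 0 = a) (p : ℝ → Bool)
    (L : List ℝ) (hp : ∀ r ∈ L, p r = false → f r = 0) (a : M) :
    walkAlong φ f (L.filter p) a = walkAlong φ f L a := by
  induction L generalizing a with
  | nil => rfl
  | cons r L ih =>
    have ih := ih fun t ht => hp t (List.mem_cons_of_mem _ ht)
    cases h : p r with
    | true => simp [h, walkAlong, ih]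
    | false => simp [h, walkAlong, ih, hp r (by simp) h, hφ]

variable [MetricSpace M] [IsUltrametricDist M]

lemma dist_walkAlong_lt {L : List ℝ} {c : ℝ} (hc : 0 < c)
    (hφ : ∀ r ∈ L, ∀ a, dist a (φ r a (f r)) ≤ r) (hL : ∀ r ∈ L, r < c) (a : M) :
    dist a (walkAlong φ f L a) < c := by
  induction L generalizing a with
  | nil => simpa [walkAlong] using hc
  | cons r L ih =>
    refine (dist_triangle_max _ (φ r a (f r)) _).trans_lt (max_lt ?_ ?_)
    · exact (hφ r (by simp) a).trans_lt (hL r (by simp))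
    · exact ih (fun t ht => hφ t (List.mem_cons_of_mem _ ht))
        (fun t ht => hL t (List.mem_cons_of_mem _ ht)) _

lemma dist_eq_of_dist_lt {a b x y : M} {r : ℝ} (hab : dist a b = r) (hx : dist a x < r)
    (hy : dist b y < r) : dist x y = r := by
  refine le_antisymm ?_ ?_
  · refine (dist_triangle_max x a y).trans (max_le (by rw [dist_comm]; exact hx.le) ?_)
    exact (dist_triangle_max a b y).trans (max_le hab.le hy.le)
  · by_contra! hlt
    have hay := (dist_triangle_max a x y).trans_lt (max_lt hx hlt)
    have := (dist_triangle_max a y b).trans_lt (max_lt hay (by rwa [dist_comm]))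
    exact this.ne hab

lemma dist_walkAlong_walkAlong {L : List ℝ} (hL : L.Pairwise (· > ·)) (hpos : ∀ r ∈ L, 0 < r)
    (hf : ∀ r ∈ L, ∀ a, dist a (φ r a (f r)) ≤ r) (hg : ∀ r ∈ L, ∀ a, dist a (φ r a (g r)) ≤ r)
    (hfg : ∀ r ∈ L, ∀ a, f r ≠ g r → dist (φ r a (f r)) (φ r a (g r)) = r) (a : M) :
    dist (walkAlong φ f L a) (walkAlong φ g L a) = sSup {r | r ∈ L ∧ f r ≠ g r} := by
  induction L generalizing a with
  | nil => simp [walkAlong]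
  | cons r L ih =>
    simp only [List.pairwise_cons, List.forall_mem_cons] at hL hpos hf hg hfg
    by_cases h : f r = g r
    · have hset : {t | t ∈ r :: L ∧ f t ≠ g t} = {t | t ∈ L ∧ f t ≠ g t} := by
        ext t
        simp only [List.mem_cons, Set.mem_ofPred_eq]
        grind
      rw [hset, ← ih hL.2 hpos.2 hf.2 hg.2 hfg.2 (φ r a (f r))]
      simp only [walkAlong, h]
    · have hmax : IsGreatest {t | t ∈ r :: L ∧ f t ≠ g t} r := by
        refine ⟨⟨by simp, h⟩, ?_⟩
        rintro t ⟨ht, -⟩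
        rcases List.mem_cons.1 ht with rfl | ht
        · exact le_rfl
        · exact (hL.1 t ht).le
      rw [hmax.csSup_eq]
      exact dist_eq_of_dist_lt (hfg.1 a h) (dist_walkAlong_lt hpos.1 hf.2 hL.1 _)
        (dist_walkAlong_lt hpos.1 hg.2 hL.1 _)

end walkAlong

lemma Finset.sort_filter_ge {α : Type*} [LinearOrder α] (p : α → Bool) (T : Finset α) :
    (T.sort (· ≥ ·)).filter p = (T.filter (fun r => p r)).sort (· ≥ ·) := by
  refine List.Perm.eq_of_pairwise' ((T.pairwise_sort (· ≥ ·)).filter _)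
    (Finset.pairwise_sort _ _) ?_
  refine (List.perm_ext_iff_of_nodup ((T.sort_nodup _).filter _) (Finset.sort_nodup _ _)).2 ?_
  simp

/-- Let `V ⊆ ℝ⁺` with `0 ∈ V` and let `s` assign to each `r ∈ V*` a
cardinal `s r ≥ 2`.  Then `M_s(Fin(V))` is isometrically embeddable into every
ultrametric space `M` satisfying property `h` with `Spec(M) ⊇ V` and `s_M(r) ≥ s r` for
every `r ∈ V*`. -/
theorem stmt13 (V : Set ℝ) (hV : V ⊆ {r : ℝ | 0 ≤ r}) (h0V : (0 : ℝ) ∈ V)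
    (s : ℝ → Cardinal.{u}) (hs : ∀ r ∈ V \ {0}, 2 ≤ s r)
    (M : Type u) [MetricSpace M]
    (ultra : ∀ x y z : M, dist x z ≤ max (dist x y) (dist y z))
    (hh : PropH M) (hspec : V ⊆ specSet M)
    (hdeg : ∀ r ∈ V \ {0}, s r ≤ degSeq M r) :
    ∃ f : MsPoint V s (FinSets V) → M,
      ∀ x y, dist (f x) (f y) = msDist x y := by
  classical
  have : IsUltrametricDist M := ⟨ultra⟩
  have hpos : ∀ r ∈ V \ {0}, 0 < r := fun r hr => lt_of_le_of_ne (hV hr.1) (Ne.symm hr.2)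
  have hs0 : ∀ r ∈ V \ {0}, s r ≠ 0 := fun r hr =>
    (lt_of_lt_of_le two_pos (hs r hr)).ne'
  obtain ⟨o, -, -⟩ := hspec h0V
  have hex : ∀ (r : ℝ) (a : M), ∃ φ : Ordinal.{u} → M, φ 0 = a ∧ (r ∈ V \ {0} →
      ∀ α < (s r).ord, ∀ β < (s r).ord, α ≠ β → dist (φ α) (φ β) = r) := by
    intro r a
    by_cases hr : r ∈ V \ {0}
    · obtain ⟨φ, h1, h2⟩ :=
        hh.exists_equidistant (hpos r hr) (hspec hr.1) (hs0 r hr) (hdeg r hr) a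
      exact ⟨φ, h1, fun _ => h2⟩
    · exact ⟨fun _ => a, rfl, fun h => absurd h hr⟩
  choose φ hφ₀ hφ using hex
  have hstep : ∀ (x : MsPoint V s (FinSets V)), ∀ r ∈ V \ {0}, ∀ a,
      dist a (φ r a (x.toFun r)) ≤ r := by
    intro x r hr a
    by_cases h : x.toFun r = 0
    · simpa [h, hφ₀] using (hpos r hr).le
    · have h0 : 0 < (s r).ord := zero_le.trans_lt (x.lt_ord r hr)
      simpa [hφ₀] using (hφ r a hr 0 h0 _ (x.lt_ord r hr) (Ne.symm h)).le
  let supp (x : MsPoint V s (FinSets V)) : Finset ℝ := x.supp_mem.2.toFinset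
  have hsupp : ∀ x r, r ∈ supp x ↔ r ∈ V \ {0} ∧ x.toFun r ≠ 0 := fun x r =>
    Set.Finite.mem_toFinset _
  have hzero : ∀ x r, r ∉ supp x → x.toFun r = 0 := by
    intro x r hr
    by_contra h
    exact hr ((hsupp x r).2 ⟨by_contra fun hrV => h (x.eq_zero r hrV), h⟩)
  have hext : ∀ x (T : Finset ℝ), supp x ⊆ T →
      walkAlong φ x.toFun ((supp x).sort (· ≥ ·)) o =
        walkAlong φ x.toFun (T.sort (· ≥ ·)) o := by
    intro x T hT
    have hfilter : T.filter (fun r => decide (r ∈ supp x) = true) = supp x := by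
      ext r
      simpa using fun h => hT h
    rw [← walkAlong_filter hφ₀ (fun r => decide (r ∈ supp x)) (T.sort (· ≥ ·))
      (fun r _ h => hzero x r (by simpa using h)), Finset.sort_filter_ge, hfilter]
  refine ⟨fun x => walkAlong φ x.toFun ((supp x).sort (· ≥ ·)) o, fun x y => ?_⟩
  have hmem : ∀ r ∈ (supp x ∪ supp y).sort (· ≥ ·), r ∈ V \ {0} := by
    intro r hr
    rcases Finset.mem_union.1 ((Finset.mem_sort _).1 hr) with h | h
    · exact ((hsupp x r).1 h).1
    · exact ((hsupp y r).1 h).1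
  beta_reduce
  rw [hext x _ Finset.subset_union_left, hext y _ Finset.subset_union_right,
    dist_walkAlong_walkAlong (Finset.sortedGT_sort _).pairwise
      (fun r hr => hpos r (hmem r hr)) (fun r hr => hstep x r (hmem r hr))
      (fun r hr => hstep y r (hmem r hr))
      (fun r hr a h => hφ r a (hmem r hr) _ (x.lt_ord r (hmem r hr)) _
        (y.lt_ord r (hmem r hr)) h)]
  unfold msDist
  congr 1
  ext r
  refine ⟨fun h => ⟨hmem r h.1, h.2⟩, fun h => ⟨?_, h.2⟩⟩
  by_contra hr
  rw [Finset.mem_sort, Finset.mem_union, not_or] at hr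
  exact h.2 ((hzero x r hr.1).trans (hzero y r hr.2).symm)
end
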